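/- Suppose d₁d₂ ≥ 2. For every integer n ≥ 1 and every 0 ≤ i ≤ n, one has Tr(Γ_i⁺ · |γ_i⟩⟨γ_i|) ≤ binom(d₁d₂ + i − 2, i), where Γ_i⁺ denotes the Moore–Penrose pseudo-inverse of Γ_i (the inverse of Γ_i on its support and zero on the orthogonal complement of its support). -/

import Mathlib

open scoped BigOperators ComplexOrder
open Classical Matrix MeasureTheory

noncomputable section

/-- Vectorization of a `d₂ × d₁` matrix: `vec(X) ∈ ℂ^{d₂} ⊗ ℂ^{d₁}`. -/
def vecM {d₁ d₂ : ℕ} (X : Matrix (Fin d₂) (Fin d₁) ℂ) : Fin d₂ × Fin d₁ → ℂ :=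
  fun p => X p.1 p.2

/-- Rank-one outer product `|v⟩⟨v|`. -/
def outer {ι : Type*} (v : ι → ℂ) : Matrix ι ι ℂ :=
  fun i j => v i * star (v j)

/-- The isometry `V₀ = ∑_{i=1}^{d₁} |i⟩⟨i|` from `ℂ^{d₁}` to `ℂ^{d₂}`. -/
def V0mat (d₁ d₂ : ℕ) : Matrix (Fin d₂) (Fin d₁) ℂ :=
  fun a b => if (a : ℕ) = (b : ℕ) then 1 else 0

/-- The isometry `Δ = ∑_{i=1}^{d₁} |d₁+i⟩⟨i|` from `ℂ^{d₁}` to `ℂ^{d₂}`. -/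
def Dmat (d₁ d₂ : ℕ) : Matrix (Fin d₂) (Fin d₁) ℂ :=
  fun a b => if (a : ℕ) = d₁ + (b : ℕ) then 1 else 0

/-- The block unitary `I_{d₁} ⊕ U` on `ℂ^{d₂}`. -/
def embedU (d₁ d₂ : ℕ) (U : Matrix (Fin (d₂ - d₁)) (Fin (d₂ - d₁)) ℂ) :
    Matrix (Fin d₂) (Fin d₂) ℂ :=
  fun a b =>
    if ha : d₁ ≤ (a : ℕ) then
      if hb : d₁ ≤ (b : ℕ) then
        U ⟨(a : ℕ) - d₁, by have := a.isLt; omega⟩ ⟨(b : ℕ) - d₁, by have := b.isLt; omega⟩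
      else 0
    else if (a : ℕ) = (b : ℕ) then 1 else 0

/-- The vector `|γ_i⟩ = binom(n,i)^{-1/2} ∑_{|S| = i} ⊗_j w_j` with `w_j = vec(Δ)` for `j ∈ S`
and `w_j = vec(V₀)` otherwise. -/
def gammaVec (d₁ d₂ n i : ℕ) : (Fin n → Fin d₂ × Fin d₁) → ℂ :=
  fun f => ((Real.sqrt (n.choose i) : ℂ))⁻¹ *
    ∑ S ∈ Finset.powersetCard i (Finset.univ : Finset (Fin n)),
      ∏ j, (if j ∈ S then vecM (Dmat d₁ d₂) (f j) else vecM (V0mat d₁ d₂) (f j))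

/-- The action of `((I_{d₁} ⊕ U)^{⊗n})_B` (acting as `I_{d₁} ⊕ U` on each `ℂ^{d₂}` factor and
trivially on each `ℂ^{d₁}` factor) on a vector of `(ℂ^{d₂} ⊗ ℂ^{d₁})^{⊗n}`. -/
def rotB (d₁ d₂ n : ℕ) (U : Matrix (Fin (d₂ - d₁)) (Fin (d₂ - d₁)) ℂ)
    (v : (Fin n → Fin d₂ × Fin d₁) → ℂ) : (Fin n → Fin d₂ × Fin d₁) → ℂ :=
  fun f => ∑ g : Fin n → Fin d₂ × Fin d₁,
    (∏ j, (embedU d₁ d₂ U (f j).1 (g j).1 * (if (f j).2 = (g j).2 then (1 : ℂ) else 0))) * v g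

instance matrixMeasurableSpace (ι κ : Type*) : MeasurableSpace (Matrix ι κ ℂ) :=
  MeasurableSpace.pi

/-- The Haar average `Γ_i = ∫ (I⊕U)_B^{⊗n} |γ_i⟩⟨γ_i| ((I⊕U)_B^{⊗n})^* dμ(U)`,
defined entrywise. -/
def GammaMat (d₁ d₂ n i : ℕ)
    (μ : Measure (Matrix.unitaryGroup (Fin (d₂ - d₁)) ℂ)) :
    Matrix (Fin n → Fin d₂ × Fin d₁) (Fin n → Fin d₂ × Fin d₁) ℂ :=
  fun f g => ∫ U, rotB d₁ d₂ n (↑U) (gammaVec d₁ d₂ n i) f *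
      star (rotB d₁ d₂ n (↑U) (gammaVec d₁ d₂ n i) g) ∂μ


/-- `P` is the Moore–Penrose pseudo-inverse of `M`. -/
def IsMoorePenrose {ι : Type*} [Fintype ι] (M P : Matrix ι ι ℂ) : Prop :=
  M * P * M = M ∧ P * M * P = P ∧ (M * P)ᴴ = M * P ∧ (P * M)ᴴ = P * M

/-- The algebra of bounded measurable complex functions. -/
def boundedMeasurable (G : Type*) [MeasurableSpace G] : Subalgebra ℂ (G → ℂ) where
  carrier := {f | Measurable f ∧ ∃ C, ∀ x, ‖f x‖ ≤ C}
  mul_mem' := by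
    rintro f g ⟨hf, C, hC⟩ ⟨hg, D, hD⟩
    refine ⟨hf.mul hg, C * D, fun x => ?_⟩
    rw [Pi.mul_apply, norm_mul]
    exact mul_le_mul (hC x) (hD x) (norm_nonneg _) ((norm_nonneg _).trans (hC x))
  add_mem' := by
    rintro f g ⟨hf, C, hC⟩ ⟨hg, D, hD⟩
    exact ⟨hf.add hg, C + D, fun x => (norm_add_le _ _).trans (add_le_add (hC x) (hD x))⟩
  algebraMap_mem' c := ⟨measurable_const, ‖c‖, fun _ => le_rfl⟩

lemma star_mem_boundedMeasurable {G : Type*} [MeasurableSpace G] {f : G → ℂ}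
    (hf : f ∈ boundedMeasurable G) : star f ∈ boundedMeasurable G := by
  obtain ⟨hf, C, hC⟩ := hf
  exact ⟨Complex.continuous_conj.measurable.comp hf, C, fun x => by simpa using hC x⟩

lemma integrable_of_mem_boundedMeasurable {G : Type*} [MeasurableSpace G] {μ : Measure G}
    [IsFiniteMeasure μ] {f : G → ℂ} (hf : f ∈ boundedMeasurable G) : Integrable f μ := by
  obtain ⟨hf, C, hC⟩ := hf
  exact Integrable.of_bound hf.aestronglyMeasurable C (Filter.Eventually.of_forall hC)

section LinearAlgebra

variable {ι κ : Type*}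

lemma IsMoorePenrose.unique [Fintype ι] {M P Q : Matrix ι ι ℂ} (hP : IsMoorePenrose M P)
    (hQ : IsMoorePenrose M Q) : P = Q := by
  obtain ⟨p1, p2, p3, p4⟩ := hP
  obtain ⟨q1, q2, q3, q4⟩ := hQ
  have h1 : M * P = M * Q := by
    calc M * P = (M * P)ᴴ := p3.symm
      _ = ((M * Q) * (M * P))ᴴ := by rw [← Matrix.mul_assoc, q1]
      _ = (M * P) * (M * Q) := by rw [conjTranspose_mul, p3, q3]
      _ = M * Q := by rw [← Matrix.mul_assoc, p1]
  have h2 : P * M = Q * M := by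
    calc P * M = (P * M)ᴴ := p4.symm
      _ = ((P * M) * (Q * M))ᴴ := by rw [Matrix.mul_assoc, ← Matrix.mul_assoc M, q1]
      _ = (Q * M) * (P * M) := by rw [conjTranspose_mul, p4, q4]
      _ = Q * M := by rw [Matrix.mul_assoc, ← Matrix.mul_assoc M, p1]
  calc P = P * (M * P) := by rw [← Matrix.mul_assoc, p2]
    _ = Q * M * Q := by rw [h1, ← Matrix.mul_assoc, h2]
    _ = Q := q2

lemma IsMoorePenrose.conj [Fintype ι] [DecidableEq ι] {M P W : Matrix ι ι ℂ} (h : IsMoorePenrose M P)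
    (hW : Wᴴ * W = 1) : IsMoorePenrose (W * M * Wᴴ) (W * P * Wᴴ) := by
  obtain ⟨p1, p2, p3, p4⟩ := h
  have key (A B : Matrix ι ι ℂ) : (W * A * Wᴴ) * (W * B * Wᴴ) = W * (A * B) * Wᴴ := by
    calc (W * A * Wᴴ) * (W * B * Wᴴ) = W * A * (Wᴴ * W) * (B * Wᴴ) := by
          simp only [Matrix.mul_assoc]
      _ = W * (A * B) * Wᴴ := by rw [hW]; simp only [Matrix.mul_one, Matrix.mul_assoc]
  have key' (A : Matrix ι ι ℂ) : (W * A * Wᴴ)ᴴ = W * Aᴴ * Wᴴ := by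
    simp only [conjTranspose_mul, conjTranspose_conjTranspose, Matrix.mul_assoc]
  refine ⟨?_, ?_, ?_, ?_⟩
  · rw [key, key, p1]
  · rw [key, key, p2]
  · rw [key, key', p3]
  · rw [key, key', p4]

lemma outer_mulVec [Fintype ι] (W : Matrix ι ι ℂ) (v : ι → ℂ) :
    outer (W *ᵥ v) = W * outer v * Wᴴ := by
  have h (u : ι → ℂ) : outer u = vecMulVec u (star u) := rfl
  rw [h, h, mul_vecMulVec, vecMulVec_mul, star_mulVec]

lemma trace_re_le_card_of_isIdempotentElem [Fintype κ] {Q : Matrix κ κ ℂ} (hQ : IsIdempotentElem Q) :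
    Q.trace.re ≤ Fintype.card κ := by
  have h : IsIdempotentElem (Matrix.toLin' Q) := by
    rw [IsIdempotentElem, Module.End.mul_eq_comp, ← Matrix.toLin'_mul, hQ.eq]
  rw [← Matrix.trace_toLin'_eq, (LinearMap.IsIdempotentElem.isProj_range _ h).trace,
    Complex.natCast_re, Nat.cast_le]
  exact (Submodule.finrank_le _).trans_eq (Module.finrank_fintype_fun_eq_card ℂ)

/-- If the orbit of `v` under a unitary representation spans at most `card κ` dimensions, then the
average `Γ` of `|w⟩⟨w|` over the orbit satisfies `Tr(Γ⁺ |v⟩⟨v|) ≤ card κ`. -/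
lemma trace_pinv_average_le [Fintype ι] [DecidableEq ι] [Fintype κ] {G : Type*} [Group G]
    [MeasurableSpace G] [MeasurableMul G]
    {μ : Measure G} [IsProbabilityMeasure μ] [μ.IsMulLeftInvariant] {W : G → Matrix ι ι ℂ}
    (hmul : ∀ g h, W (g * h) = W g * W h) (hW : ∀ g, (W g)ᴴ * W g = 1)
    {v : ι → ℂ} {L : Matrix ι κ ℂ} {m : κ → G → ℂ} (hm : ∀ k, m k ∈ boundedMeasurable G)
    (hL : ∀ g, W g *ᵥ v = L *ᵥ fun k => m k g) {Γ P : Matrix ι ι ℂ}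
    (hΓ : ∀ a b, Γ a b = ∫ g, outer (W g *ᵥ v) a b ∂μ) (hP : IsMoorePenrose Γ P) :
    (Matrix.trace (P * outer v)).re ≤ Fintype.card κ := by
  have hmem (a : ι) : (fun g => (W g *ᵥ v) a) ∈ boundedMeasurable G := by
    have : (fun g => (W g *ᵥ v) a) = ∑ k, L a k • m k := by
      ext g
      rw [hL]
      simp [mulVec, dotProduct]
    rw [this]
    exact sum_mem fun k _ => Subalgebra.smul_mem _ (hm k) _
  have hint (a b : ι) : Integrable (fun g => outer (W g *ᵥ v) a b) μ :=
    integrable_of_mem_boundedMeasurable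
      (mul_mem (hmem a) (star_mem_boundedMeasurable (hmem b)))
  have hsum (A B : Matrix ι ι ℂ) (a b : ι) :
      (A * Γ * B) a b = ∫ g, (A * outer (W g *ᵥ v) * B) a b ∂μ := by
    simp only [Matrix.mul_apply, hΓ]
    rw [integral_finsetSum _ fun c _ =>
      (integrable_finsetSum _ fun d _ => (hint d c).const_mul _).mul_const _]
    refine Finset.sum_congr rfl fun c _ => ?_
    rw [integral_mul_const, integral_finsetSum _ fun d _ => (hint d c).const_mul _]
    simp only [integral_const_mul]
  have hinv (h : G) : W h * Γ * (W h)ᴴ = Γ := by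
    ext a b
    rw [hsum, hΓ, ← integral_mul_left_eq_self (fun g => outer (W g *ᵥ v) a b) h]
    simp only [← outer_mulVec, mulVec_mulVec, ← hmul]
  have hPinv (h : G) : W h * P * (W h)ᴴ = P :=
    IsMoorePenrose.unique (M := Γ) (by simpa only [hinv] using hP.conj (hW h)) hP
  have hconst (g : G) : Matrix.trace (P * outer (W g *ᵥ v)) = Matrix.trace (P * outer v) := by
    calc Matrix.trace (P * outer (W g *ᵥ v))
        = Matrix.trace ((W g * P * (W g)ᴴ) * (W g * outer v * (W g)ᴴ)) := by
          rw [hPinv, outer_mulVec]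
      _ = Matrix.trace (W g * (P * ((W g)ᴴ * W g) * outer v * (W g)ᴴ)) := by
          simp only [Matrix.mul_assoc]
      _ = Matrix.trace (P * ((W g)ᴴ * W g) * outer v * ((W g)ᴴ * W g)) := by
          rw [Matrix.trace_mul_comm, Matrix.mul_assoc _ _ (W g)]
      _ = Matrix.trace (P * outer v) := by rw [hW, Matrix.mul_one, Matrix.mul_one]
  have htrace : Matrix.trace (P * outer v) = Matrix.trace (P * Γ) := by
    have h (a : ι) : (P * Γ) a a = ∫ g, (P * outer (W g *ᵥ v)) a a ∂μ := by
      simpa only [Matrix.mul_one] using hsum P 1 a a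
    have hi (a : ι) : Integrable (fun g => (P * outer (W g *ᵥ v)) a a) μ := by
      simp only [Matrix.mul_apply]
      exact integrable_finsetSum _ fun d _ => (hint d a).const_mul _
    simp only [Matrix.trace, Matrix.diag, h]
    rw [← integral_finsetSum _ fun a _ => hi a]
    have h' (g : G) : ∑ a, (P * outer (W g *ᵥ v)) a a = ∑ a, (P * outer v) a a := hconst g
    simp only [h', integral_const, probReal_univ, one_smul]
  obtain ⟨M, hM⟩ : ∃ M : Matrix κ ι ℂ, Γ = L * M := by
    refine ⟨Matrix.of fun k b => ∫ g, m k g * star ((W g *ᵥ v) b) ∂μ, ?_⟩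
    ext a b
    rw [hΓ, Matrix.mul_apply]
    simp only [Matrix.of_apply, ← integral_const_mul]
    have hi (k : κ) : Integrable (fun g => L a k * (m k g * star ((W g *ᵥ v) b))) μ :=
      (integrable_of_mem_boundedMeasurable
        (mul_mem (hm k) (star_mem_boundedMeasurable (hmem b)))).const_mul _
    rw [← integral_finsetSum _ fun k _ => hi k]
    refine integral_congr_ae (Filter.Eventually.of_forall fun g => ?_)
    have h : (W g *ᵥ v) a = ∑ k, L a k * m k g := by rw [hL]; rfl
    simp only [outer]
    rw [h, Finset.sum_mul]
    simp only [mul_assoc]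
  have hidem : IsIdempotentElem (M * P * L) := by
    calc M * P * L * (M * P * L) = M * (P * (L * M) * P) * L := by
          simp only [Matrix.mul_assoc]
      _ = M * P * L := by rw [← hM, hP.2.1]
  rw [htrace, hM, ← Matrix.mul_assoc, Matrix.trace_mul_comm, ← Matrix.mul_assoc]
  exact trace_re_le_card_of_isIdempotentElem hidem

/-- The `n`-fold tensor power of a square matrix. -/
def tensorPow (n : ℕ) (A : Matrix ι ι ℂ) : Matrix (Fin n → ι) (Fin n → ι) ℂ :=
  fun f g => ∏ j, A (f j) (g j)

lemma tensorPow_mul [Fintype ι] (n : ℕ) (A B : Matrix ι ι ℂ) :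
    tensorPow n (A * B) = tensorPow n A * tensorPow n B := by
  ext f g
  simp only [tensorPow, Matrix.mul_apply, ← Finset.prod_mul_distrib]
  exact Fintype.prod_sum _

lemma tensorPow_one [DecidableEq ι] (n : ℕ) : tensorPow n (1 : Matrix ι ι ℂ) = 1 := by
  ext f g
  by_cases h : f = g
  · subst h
    rw [Matrix.one_apply_eq]
    exact Finset.prod_eq_one fun j _ => Matrix.one_apply_eq (f j)
  · obtain ⟨j, hj⟩ := Function.ne_iff.mp h
    rw [Matrix.one_apply_ne h]
    exact Finset.prod_eq_zero (Finset.mem_univ j) (Matrix.one_apply_ne hj)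

lemma tensorPow_conjTranspose (n : ℕ) (A : Matrix ι ι ℂ) :
    tensorPow n Aᴴ = (tensorPow n A)ᴴ := by
  ext f g
  simp [tensorPow, conjTranspose_apply]

lemma tensorPow_mulVec_prod [Fintype ι] (n : ℕ) (A : Matrix ι ι ℂ) (w : Fin n → ι → ℂ) :
    tensorPow n A *ᵥ (fun g => ∏ j, w j (g j)) = fun f => ∏ j, (A *ᵥ w j) (f j) := by
  ext f
  simp only [tensorPow, mulVec, dotProduct, ← Finset.prod_mul_distrib]
  exact (Fintype.prod_sum fun j k => A (f j) k * w j k).symm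

end LinearAlgebra

section Rotation

open scoped Kronecker

variable {d₁ d₂ : ℕ}

/-- The splitting of `Fin d₂` into the first `d₁` indices and the rest. -/
def blockEquiv (h : d₁ ≤ d₂) : Fin d₁ ⊕ Fin (d₂ - d₁) ≃ Fin d₂ :=
  finSumFinEquiv.trans (finCongr (Nat.add_sub_cancel' h))

lemma embedU_eq (h : d₁ ≤ d₂) (U : Matrix (Fin (d₂ - d₁)) (Fin (d₂ - d₁)) ℂ) :
    embedU d₁ d₂ U =
      (fromBlocks 1 0 0 U).submatrix (blockEquiv h).symm (blockEquiv h).symm := by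
  ext a b
  obtain ⟨x, rfl⟩ := (blockEquiv h).surjective a
  obtain ⟨y, rfl⟩ := (blockEquiv h).surjective b
  rcases x with x | x <;> rcases y with y | y
  · simp [embedU, blockEquiv, Matrix.one_apply, Fin.ext_iff]
  · have := x.isLt
    simp only [embedU, blockEquiv, Equiv.trans_apply, finSumFinEquiv_apply_left,
      finSumFinEquiv_apply_right, finCongr_apply, Fin.val_cast, Fin.val_castAdd, Fin.val_natAdd,
      submatrix_apply, Equiv.symm_trans_apply, finCongr_symm, Fin.cast_cast, Fin.cast_eq_self,
      finSumFinEquiv_symm_apply_castAdd, finSumFinEquiv_symm_apply_natAdd, fromBlocks_apply₁₂,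
      Matrix.zero_apply]
    split_ifs <;> first | omega | rfl
  · simp [embedU, blockEquiv]
  · simp [embedU, blockEquiv]

lemma embedU_mul (h : d₁ ≤ d₂) (U V : Matrix (Fin (d₂ - d₁)) (Fin (d₂ - d₁)) ℂ) :
    embedU d₁ d₂ (U * V) = embedU d₁ d₂ U * embedU d₁ d₂ V := by
  simp [embedU_eq h, fromBlocks_multiply]

lemma embedU_one (h : d₁ ≤ d₂) : embedU d₁ d₂ 1 = 1 := by
  simp [embedU_eq h]

lemma embedU_conjTranspose (h : d₁ ≤ d₂) (U : Matrix (Fin (d₂ - d₁)) (Fin (d₂ - d₁)) ℂ) :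
    embedU d₁ d₂ Uᴴ = (embedU d₁ d₂ U)ᴴ := by
  simp [embedU_eq h, fromBlocks_conjTranspose]

lemma embedU_mul_V0mat (h : d₁ ≤ d₂) (U : Matrix (Fin (d₂ - d₁)) (Fin (d₂ - d₁)) ℂ) :
    embedU d₁ d₂ U * V0mat d₁ d₂ = V0mat d₁ d₂ := by
  ext a b
  rw [Matrix.mul_apply, Finset.sum_eq_single ⟨b, b.isLt.trans_le h⟩]
  · have := b.isLt
    simp only [embedU, V0mat]
    split_ifs <;> simp <;> omega
  · intro c _ hc
    have : (c : ℕ) ≠ b := fun h => hc (Fin.ext h)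
    simp [V0mat, this]
  · simp

lemma embedU_mul_Dmat_zero (h₀ : 0 < d₁) (U : Matrix (Fin (d₂ - d₁)) (Fin (d₂ - d₁)) ℂ)
    (a : Fin d₂) (b : Fin d₁) (ha : (a : ℕ) = 0) : (embedU d₁ d₂ U * Dmat d₁ d₂) a b = 0 := by
  rw [Matrix.mul_apply]
  refine Finset.sum_eq_zero fun c _ => ?_
  simp only [embedU, Dmat]
  split_ifs <;> first | omega | simp

/-- The matrix of `rotB`. -/
def rotMat (d₁ d₂ n : ℕ) (U : Matrix (Fin (d₂ - d₁)) (Fin (d₂ - d₁)) ℂ) :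
    Matrix (Fin n → Fin d₂ × Fin d₁) (Fin n → Fin d₂ × Fin d₁) ℂ :=
  tensorPow n (embedU d₁ d₂ U ⊗ₖ (1 : Matrix (Fin d₁) (Fin d₁) ℂ))

lemma rotB_eq_mulVec (n : ℕ) (U : Matrix (Fin (d₂ - d₁)) (Fin (d₂ - d₁)) ℂ)
    (v : (Fin n → Fin d₂ × Fin d₁) → ℂ) : rotB d₁ d₂ n U v = rotMat d₁ d₂ n U *ᵥ v := by
  ext f
  simp only [rotB, rotMat, tensorPow, mulVec, dotProduct, kroneckerMap_apply, Matrix.one_apply]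

lemma rotMat_mul (h : d₁ ≤ d₂) (n : ℕ) (U V : Matrix (Fin (d₂ - d₁)) (Fin (d₂ - d₁)) ℂ) :
    rotMat d₁ d₂ n (U * V) = rotMat d₁ d₂ n U * rotMat d₁ d₂ n V := by
  rw [rotMat, rotMat, rotMat, ← tensorPow_mul, ← mul_kronecker_mul, embedU_mul h, Matrix.one_mul]

lemma rotMat_conjTranspose_mul_self (h : d₁ ≤ d₂) (n : ℕ)
    (U : Matrix.unitaryGroup (Fin (d₂ - d₁)) ℂ) :
    (rotMat d₁ d₂ n (U : Matrix _ _ ℂ))ᴴ * rotMat d₁ d₂ n (U : Matrix _ _ ℂ) = 1 := by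
  have hU : (U : Matrix (Fin (d₂ - d₁)) (Fin (d₂ - d₁)) ℂ)ᴴ * (U : Matrix _ _ ℂ) = 1 :=
    Unitary.coe_star_mul_self U
  have : (rotMat d₁ d₂ n (U : Matrix _ _ ℂ))ᴴ = rotMat d₁ d₂ n (U : Matrix _ _ ℂ)ᴴ := by
    rw [rotMat, rotMat, ← tensorPow_conjTranspose, conjTranspose_kronecker,
      embedU_conjTranspose h, conjTranspose_one]
  rw [this, ← rotMat_mul h, hU, rotMat, embedU_one h, one_kronecker_one, tensorPow_one]

lemma kronecker_one_mulVec_vecM (A : Matrix (Fin d₂) (Fin d₂) ℂ)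
    (X : Matrix (Fin d₂) (Fin d₁) ℂ) :
    (A ⊗ₖ (1 : Matrix (Fin d₁) (Fin d₁) ℂ)) *ᵥ vecM X = vecM (A * X) := by
  ext ⟨a, b⟩
  simp [mulVec, dotProduct, vecM, Matrix.mul_apply, Fintype.sum_prod_type, Matrix.one_apply]

lemma rotMat_mulVec_gammaVec (h : d₁ ≤ d₂) (n i : ℕ)
    (U : Matrix (Fin (d₂ - d₁)) (Fin (d₂ - d₁)) ℂ) (f : Fin n → Fin d₂ × Fin d₁) :
    (rotMat d₁ d₂ n U *ᵥ gammaVec d₁ d₂ n i) f = ((Real.sqrt (n.choose i) : ℂ))⁻¹ *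
      ∑ S ∈ Finset.powersetCard i (Finset.univ : Finset (Fin n)),
        (∏ j ∈ S, vecM (embedU d₁ d₂ U * Dmat d₁ d₂) (f j)) *
          ∏ j ∈ Sᶜ, vecM (V0mat d₁ d₂) (f j) := by
  have hγ : gammaVec d₁ d₂ n i = ((Real.sqrt (n.choose i) : ℂ))⁻¹ •
      ∑ S ∈ Finset.powersetCard i (Finset.univ : Finset (Fin n)),
        fun g => ∏ j, (if j ∈ S then vecM (Dmat d₁ d₂) else vecM (V0mat d₁ d₂)) (g j) := by
    ext g
    simp only [gammaVec, Pi.smul_apply, Finset.sum_apply, smul_eq_mul, ite_apply]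
  rw [hγ, mulVec_smul, mulVec_sum, Pi.smul_apply, Finset.sum_apply, smul_eq_mul]
  congr 1
  refine Finset.sum_congr rfl fun S _ => ?_
  rw [rotMat, tensorPow_mulVec_prod]
  refine (Finset.prod_mul_prod_compl S _).symm.trans ?_
  congr 1
  · refine Finset.prod_congr rfl fun j hj => ?_
    rw [if_pos hj, kronecker_one_mulVec_vecM]
  · refine Finset.prod_congr rfl fun j hj => ?_
    rw [if_neg (Finset.mem_compl.mp hj), kronecker_one_mulVec_vecM, embedU_mul_V0mat h]

lemma vecM_embedU_mul_Dmat_mem (p : Fin d₂ × Fin d₁) :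
    (fun U : Matrix.unitaryGroup (Fin (d₂ - d₁)) ℂ =>
      vecM (embedU d₁ d₂ (U : Matrix _ _ ℂ) * Dmat d₁ d₂) p) ∈ boundedMeasurable _ := by
  have hentry (a b : Fin (d₂ - d₁)) :
      (fun U : Matrix.unitaryGroup (Fin (d₂ - d₁)) ℂ => (U : Matrix _ _ ℂ) a b) ∈
        boundedMeasurable _ :=
    ⟨(measurable_pi_apply b).comp ((measurable_pi_apply a).comp measurable_subtype_coe), 1,
      fun U => entry_norm_bound_of_unitary U.2 a b⟩
  have hembed (a b : Fin d₂) :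
      (fun U : Matrix.unitaryGroup (Fin (d₂ - d₁)) ℂ => embedU d₁ d₂ (U : Matrix _ _ ℂ) a b) ∈
        boundedMeasurable _ := by
    unfold embedU
    split_ifs
    · exact hentry _ _
    · exact zero_mem _
    · exact one_mem _
    · exact zero_mem _
  have : (fun U : Matrix.unitaryGroup (Fin (d₂ - d₁)) ℂ =>
      vecM (embedU d₁ d₂ (U : Matrix _ _ ℂ) * Dmat d₁ d₂) p) =
      ∑ c, Dmat d₁ d₂ c p.2 • fun U : Matrix.unitaryGroup (Fin (d₂ - d₁)) ℂ =>
        embedU d₁ d₂ (U : Matrix _ _ ℂ) p.1 c := by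
    ext U
    simp [vecM, Matrix.mul_apply, mul_comm]
  rw [this]
  exact sum_mem fun c _ => Subalgebra.smul_mem _ (hembed _ _) _

end Rotation

instance measurableMul_unitaryGroup (k : ℕ) : MeasurableMul (Matrix.unitaryGroup (Fin k) ℂ) where
  measurable_const_mul V := by
    refine Measurable.subtype_mk (measurable_pi_lambda _ fun a => measurable_pi_lambda _ fun b => ?_)
    simp only [Matrix.mul_apply]
    exact Finset.measurable_sum _ fun c _ => measurable_const.mul
      ((measurable_pi_apply b).comp ((measurable_pi_apply c).comp measurable_subtype_coe))
  measurable_mul_const V := by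
    refine Measurable.subtype_mk (measurable_pi_lambda _ fun a => measurable_pi_lambda _ fun b => ?_)
    simp only [Matrix.mul_apply]
    refine Finset.measurable_sum _ fun c _ => Measurable.mul ?_ measurable_const
    exact (measurable_pi_apply c).comp ((measurable_pi_apply a).comp measurable_subtype_coe)

/-- If `y` vanishes identically at `p₀`, products of `i` of the remaining `y p` span
all products of `i` of the `y p`. -/
lemma prod_mem_span_sym {α β G : Type*} {p₀ : β} {y : β → G → ℂ} (hy : y p₀ = 0)
    (S : Finset α) (f : α → β) :
    (∏ j ∈ S, y (f j)) ∈ Submodule.span ℂ (Set.range fun s : Sym {p // p ≠ p₀} S.card =>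
      ((s : Multiset {p // p ≠ p₀}).map fun p : {p // p ≠ p₀} => y p).prod) := by
  by_cases h : ∀ j ∈ S, f j ≠ p₀
  · refine Submodule.subset_span
      ⟨⟨S.attach.val.map fun j : S => ⟨f j, h j j.2⟩,
        by rw [Multiset.card_map, Finset.card_val, Finset.card_attach]⟩, ?_⟩
    simp only [Sym.coe_mk, Multiset.map_map, Function.comp_def]
    exact Finset.prod_attach S fun j => y (f j)
  · push Not at h
    obtain ⟨j, hj, hj'⟩ := h
    rw [Finset.prod_eq_zero hj (by rw [hj', hy])]
    exact zero_mem _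

/-- `Tr(Γ_i⁺ · |γ_i⟩⟨γ_i|) ≤ binom(d₁d₂ + i - 2, i)`. -/
theorem trace_Gamma_pinv_gamma_le (d₁ d₂ : ℕ) (hd₁ : 0 < d₁) (hd : 2 * d₁ ≤ d₂)
    (hdd : 2 ≤ d₁ * d₂) (n : ℕ) (hn : 1 ≤ n) (i : ℕ) (hi : i ≤ n)
    (μ : Measure (Matrix.unitaryGroup (Fin (d₂ - d₁)) ℂ)) [IsProbabilityMeasure μ]
    [μ.IsMulLeftInvariant] [μ.IsMulRightInvariant]
    (P : Matrix (Fin n → Fin d₂ × Fin d₁) (Fin n → Fin d₂ × Fin d₁) ℂ)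
    (hP : IsMoorePenrose (GammaMat d₁ d₂ n i μ) P) :
    (Matrix.trace (P * outer (gammaVec d₁ d₂ n i))).re ≤ ((d₁ * d₂ + i - 2).choose i : ℝ) := by
  have hle : d₁ ≤ d₂ := by omega
  let p₀ : Fin d₂ × Fin d₁ := (⟨0, by omega⟩, ⟨0, hd₁⟩)
  let y : Fin d₂ × Fin d₁ → Matrix.unitaryGroup (Fin (d₂ - d₁)) ℂ → ℂ := fun p U =>
    vecM (embedU d₁ d₂ (U : Matrix _ _ ℂ) * Dmat d₁ d₂) p
  have hy₀ : y p₀ = 0 := funext fun U => embedU_mul_Dmat_zero hd₁ _ _ _ rfl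
  let m : Sym {p // p ≠ p₀} i → Matrix.unitaryGroup (Fin (d₂ - d₁)) ℂ → ℂ := fun s =>
    ((s : Multiset {p // p ≠ p₀}).map fun p : {p // p ≠ p₀} => y p).prod
  have hm (s) : m s ∈ boundedMeasurable _ := by
    refine Subalgebra.multiset_prod_mem _ fun z hz => ?_
    obtain ⟨p, -, rfl⟩ := Multiset.mem_map.mp hz
    exact vecM_embedU_mul_Dmat_mem _
  have hspan (f : Fin n → Fin d₂ × Fin d₁) :
      (fun U : Matrix.unitaryGroup (Fin (d₂ - d₁)) ℂ =>
        (rotMat d₁ d₂ n (U : Matrix _ _ ℂ) *ᵥ gammaVec d₁ d₂ n i) f) ∈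
        Submodule.span ℂ (Set.range m) := by
    have : (fun U : Matrix.unitaryGroup (Fin (d₂ - d₁)) ℂ =>
          (rotMat d₁ d₂ n (U : Matrix _ _ ℂ) *ᵥ gammaVec d₁ d₂ n i) f) =
        ((Real.sqrt (n.choose i) : ℂ))⁻¹ •
          ∑ S ∈ Finset.powersetCard i (Finset.univ : Finset (Fin n)),
            (∏ j ∈ Sᶜ, vecM (V0mat d₁ d₂) (f j)) • ∏ j ∈ S, y (f j) := by
      ext U
      simp [rotMat_mulVec_gammaVec hle, y, mul_comm]
    rw [this]
    refine Submodule.smul_mem _ _ (Submodule.sum_mem _ fun S hS => Submodule.smul_mem _ _ ?_)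
    obtain rfl := (Finset.mem_powersetCard.mp hS).2
    exact prod_mem_span_sym hy₀ S f
  choose L hL using fun f => (Submodule.mem_span_range_iff_exists_fun ℂ).mp (hspan f)
  have hcard : Fintype.card (Sym {p // p ≠ p₀} i) = (d₁ * d₂ + i - 2).choose i := by
    rw [Sym.card_sym_eq_choose]
    congr 1
    simp only [ne_eq, Fintype.card_subtype_compl, Fintype.card_prod, Fintype.card_fin,
      Fintype.card_unique, mul_comm d₂]
    omega
  rw [← hcard]
  have hW (U : Matrix.unitaryGroup (Fin (d₂ - d₁)) ℂ) :
      rotMat d₁ d₂ n (U : Matrix _ _ ℂ) *ᵥ gammaVec d₁ d₂ n i =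
        Matrix.of L *ᵥ fun s => m s U := by
    ext f
    rw [← congrFun (hL f) U]
    simp [mulVec, dotProduct]
  have hΓ (f g) : GammaMat d₁ d₂ n i μ f g = ∫ U : Matrix.unitaryGroup (Fin (d₂ - d₁)) ℂ,
      outer (rotMat d₁ d₂ n (U : Matrix _ _ ℂ) *ᵥ gammaVec d₁ d₂ n i) f g ∂μ := by
    simp only [GammaMat, rotB_eq_mulVec, outer]
  exact trace_pinv_average_le (fun U V => rotMat_mul hle n _ _)
    (rotMat_conjTranspose_mul_self hle n) hm hW hΓ hP

end
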